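/- Let n, m be positive integers and let (r,s) and (r',s') be pairs of natural numbers with s, s' even, s ≤ r ≤ m, 2r − s ≤ 2n, s' ≤ r' ≤ m, and 2r' − s' ≤ 2n. For natural numbers a, b let O_{ab} denote the set of complex (2n)×m matrices x with rank(x) = a and rank(xᵀ·J·x) = b. Then O_{rs} is contained in the closure of O_{r's'} (in the standard topology on the space of complex (2n)×m matrices) if and only if r ≤ r' and s ≤ s'. -/

import Mathlib

open Matrix

/-- The standard symplectic matrix `J = [[0, 1ₙ], [-1ₙ, 0]]`. -/
def symJ (n : ℕ) : Matrix (Fin n ⊕ Fin n) (Fin n ⊕ Fin n) ℂ :=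
  Matrix.fromBlocks 0 1 (-1) 0

section RankPerturbation

variable {K ι κ : Type*} [Field K] [Fintype κ]

/-- A vector outside the row space of `M` is detected by some vector of the kernel of `M`. -/
lemma exists_mulVec_eq_zero_of_notMem_range_transpose [Fintype ι] (M : Matrix ι κ K) {φ : κ → K}
    (hφ : φ ∉ LinearMap.range Mᵀ.mulVecLin) : ∃ w, M *ᵥ w = 0 ∧ φ ⬝ᵥ w = 1 := by
  classical
  obtain ⟨f, hf, hf'⟩ := Submodule.exists_dual_map_eq_bot_of_notMem hφ inferInstance
  obtain ⟨w, rfl⟩ := (dotProductEquiv K κ).surjective f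
  simp only [dotProductEquiv_apply_apply] at hf
  have hw : M *ᵥ w = 0 := by
    refine dotProduct_eq_zero _ fun y => ?_
    have : (dotProductEquiv K κ w) (Mᵀ *ᵥ y) = 0 := by
      have h : (dotProductEquiv K κ w) (Mᵀ *ᵥ y) ∈
          (LinearMap.range Mᵀ.mulVecLin).map (dotProductEquiv K κ w) :=
        Submodule.mem_map_of_mem ⟨y, rfl⟩
      rwa [hf', Submodule.mem_bot] at h
    rwa [dotProductEquiv_apply_apply, mulVec_transpose, dotProduct_comm, ← dotProduct_mulVec,
      dotProduct_comm] at this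
  refine ⟨(φ ⬝ᵥ w)⁻¹ • w, by rw [mulVec_smul, hw, smul_zero], ?_⟩
  rw [dotProduct_smul, smul_eq_mul, inv_mul_cancel₀]
  rwa [dotProduct_comm]

/-- The column space of a rank-one perturbation is contained in the span of the column space and
the perturbing column. -/
lemma range_mulVecLin_add_vecMulVec_le (M : Matrix ι κ K) (u : ι → K) (φ : κ → K) :
    LinearMap.range (M + vecMulVec u φ).mulVecLin ≤
      LinearMap.range M.mulVecLin ⊔ Submodule.span K {u} := by
  rintro _ ⟨v, rfl⟩
  rw [mulVecLin_apply, add_mulVec, vecMulVec_mulVec]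
  refine Submodule.add_mem_sup ⟨v, rfl⟩ ?_
  rw [op_smul_eq_smul]
  exact Submodule.smul_mem _ _ (Submodule.mem_span_singleton_self u)

lemma rank_add_vecMulVec [Fintype ι] (M : Matrix ι κ K) {u : ι → K} {φ : κ → K}
    (hu : u ∉ LinearMap.range M.mulVecLin) (hφ : φ ∉ LinearMap.range Mᵀ.mulVecLin) :
    (M + vecMulVec u φ).rank = M.rank + 1 := by
  obtain ⟨w, hw, hφw⟩ := exists_mulVec_eq_zero_of_notMem_range_transpose M hφ
  have hmem : u ∈ LinearMap.range (M + vecMulVec u φ).mulVecLin :=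
    ⟨w, by rw [mulVecLin_apply, add_mulVec, vecMulVec_mulVec, hw, hφw]; simp⟩
  have hrange : LinearMap.range (M + vecMulVec u φ).mulVecLin =
      LinearMap.range M.mulVecLin ⊔ Submodule.span K {u} := by
    refine le_antisymm (range_mulVecLin_add_vecMulVec_le M u φ) (sup_le ?_ ?_)
    · rintro _ ⟨v, rfl⟩
      have : M *ᵥ v = (M + vecMulVec u φ) *ᵥ v - (φ ⬝ᵥ v) • u := by
        rw [add_mulVec, vecMulVec_mulVec, op_smul_eq_smul, add_sub_cancel_right]
      rw [mulVecLin_apply, this]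
      exact Submodule.sub_mem _ ⟨v, rfl⟩ (Submodule.smul_mem _ _ hmem)
    · rwa [Submodule.span_singleton_le_iff_mem]
  rw [Matrix.rank, hrange, Submodule.finrank_sup_span_singleton hu, Matrix.rank]

lemma range_mulVecLin_neg (M : Matrix ι κ K) :
    LinearMap.range (-M).mulVecLin = LinearMap.range M.mulVecLin := by
  have : (-M).mulVecLin = -M.mulVecLin := by ext; simp
  rw [this, LinearMap.range_neg]

lemma notMem_sup_span_singleton_exchange {V : Type*} [AddCommGroup V] [Module K V]
    {C : Submodule K V} {a b : V} (ha : a ∉ C) (hb : b ∉ C ⊔ Submodule.span K {a}) :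
    a ∉ C ⊔ Submodule.span K {b} := by
  have key : ∀ v, C ⊔ Submodule.span K {v} = Submodule.span K (insert v (C : Set V)) := fun v => by
    rw [Submodule.span_insert, Submodule.span_eq, sup_comm]
  rw [key] at hb ⊢
  exact fun h => hb (mem_span_insert_exchange h (by rwa [Submodule.span_eq]))

/-- Adding to a skew-symmetric matrix the skew-symmetric rank-two matrix built from two vectors
independent modulo its column space raises the rank by two. -/
lemma rank_add_vecMulVec_sub_vecMulVec (F : Matrix κ κ K) (hF : Fᵀ = -F) {a φ : κ → K}
    (ha : a ∉ LinearMap.range F.mulVecLin)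
    (hφ : φ ∉ LinearMap.range F.mulVecLin ⊔ Submodule.span K {a}) :
    (F + vecMulVec a φ - vecMulVec φ a).rank = F.rank + 2 := by
  have hrow : LinearMap.range Fᵀ.mulVecLin = LinearMap.range F.mulVecLin := by
    rw [hF, range_mulVecLin_neg]
  have h₁ : (F + vecMulVec a φ).rank = F.rank + 1 :=
    rank_add_vecMulVec F ha fun h => hφ (Submodule.mem_sup_left (hrow ▸ h))
  have h₂ : φ ∉ LinearMap.range (F + vecMulVec a φ).mulVecLin := fun h =>
    hφ (range_mulVecLin_add_vecMulVec_le F a φ h)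
  have h₃ : -a ∉ LinearMap.range (F + vecMulVec a φ)ᵀ.mulVecLin := by
    rw [transpose_add, transpose_vecMulVec, Submodule.neg_mem_iff]
    intro h
    have := range_mulVecLin_add_vecMulVec_le _ _ _ h
    rw [hrow] at this
    exact notMem_sup_span_singleton_exchange ha hφ this
  rw [sub_eq_add_neg, ← vecMulVec_neg, rank_add_vecMulVec _ h₂ h₃, h₁]

end RankPerturbation

lemma isClosed_setOf_rank_le {ι κ : Type*} [Fintype ι] [Fintype κ] (k : ℕ) :
    IsClosed {A : Matrix ι κ ℂ | A.rank ≤ k} := by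
  classical
  let L : Matrix ι κ ℂ →ₗ[ℂ] ((κ → ℂ) →L[ℂ] (ι → ℂ)) :=
    LinearMap.toContinuousLinearMap.toLinearMap ∘ₗ (Matrix.toLin' (R := ℂ)).toLinearMap
  have hopen := (isOpen_setOfPred_nat_le_rank (𝕜 := ℂ) (E := κ → ℂ)
    (F := ι → ℂ) (k + 1)).preimage L.continuous_of_finiteDimensional
  rw [← isOpen_compl_iff]
  convert hopen using 1
  ext A
  change ¬ A.rank ≤ k ↔ ((k + 1 : ℕ) : Cardinal) ≤ A.mulVecLin.rank
  rw [LinearMap.rank, ← Module.finrank_eq_rank, Nat.cast_le, not_le]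
  rfl

section Orbits

variable {n m : ℕ}

lemma symJ_eq_neg_J (n : ℕ) : symJ n = -J (Fin n) ℂ := by
  simp [symJ, J, fromBlocks_neg]

lemma symJ_transpose (n : ℕ) : (symJ n)ᵀ = -symJ n := by
  rw [symJ_eq_neg_J, transpose_neg, J_transpose]

lemma isUnit_det_symJ (n : ℕ) : IsUnit (symJ n).det := by
  rw [symJ_eq_neg_J, ← J_transpose, det_transpose]
  exact isUnit_det_J _ _

lemma transpose_gram (x : Matrix (Fin n ⊕ Fin n) (Fin m) ℂ) :
    (xᵀ * symJ n * x)ᵀ = -(xᵀ * symJ n * x) := by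
  simp [transpose_mul, symJ_transpose, Matrix.mul_assoc]

/-- The Gram matrix of the symplectic form after a rank-one perturbation. -/
lemma gram_add_vecMulVec (x : Matrix (Fin n ⊕ Fin n) (Fin m) ℂ) (u : Fin n ⊕ Fin n → ℂ)
    (φ : Fin m → ℂ) :
    (x + vecMulVec u φ)ᵀ * symJ n * (x + vecMulVec u φ) =
      xᵀ * symJ n * x + vecMulVec ((xᵀ * symJ n) *ᵥ u) φ
        - vecMulVec φ ((xᵀ * symJ n) *ᵥ u) := by
  have huu : u ᵥ* symJ n ⬝ᵥ u = 0 := by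
    have h : u ᵥ* symJ n ⬝ᵥ u = -(u ᵥ* symJ n ⬝ᵥ u) := by
      conv_lhs => rw [dotProduct_comm, ← mulVec_transpose, symJ_transpose, neg_mulVec,
        dotProduct_neg, dotProduct_mulVec]
    exact self_eq_neg.mp h
  have hux : u ᵥ* symJ n ᵥ* x = -((xᵀ * symJ n) *ᵥ u) := by
    rw [← mulVec_transpose, ← mulVec_transpose, mulVec_mulVec, symJ_transpose, Matrix.mul_neg,
      neg_mulVec]
  rw [transpose_add, transpose_vecMulVec, Matrix.add_mul, Matrix.add_mul, Matrix.mul_add,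
    Matrix.mul_add, mul_vecMulVec, vecMulVec_mul, vecMulVec_mul, vecMulVec_mul_vecMulVec, huu, hux]
  simp [vecMulVec_neg, sub_eq_add_neg]

/-- The set of matrices of rank `r` whose column space carries a form of rank `s`. -/
def rankStratum (n m r s : ℕ) : Set (Matrix (Fin n ⊕ Fin n) (Fin m) ℂ) :=
  {x | x.rank = r ∧ (xᵀ * symJ n * x).rank = s}

lemma mem_closure_of_eventually_add_smul {ι κ : Type*} {S : Set (Matrix ι κ ℂ)} {x y : Matrix ι κ ℂ}
    (h : ∀ᶠ t : ℂ in nhdsWithin 0 {0}ᶜ, x + t • y ∈ S) : x ∈ closure S := by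
  refine mem_closure_of_tendsto (f := fun t : ℂ => x + t • y) ?_ h
  have : Continuous fun t : ℂ => x + t • y := by fun_prop
  simpa using (this.tendsto 0).mono_left nhdsWithin_le_nhds

lemma range_gram_le (x : Matrix (Fin n ⊕ Fin n) (Fin m) ℂ) :
    LinearMap.range (xᵀ * symJ n * x).mulVecLin ≤ LinearMap.range xᵀ.mulVecLin := by
  rw [Matrix.mul_assoc, mulVecLin_mul]
  exact LinearMap.range_comp_le_range _ _

lemma exists_mulVec_eq_of_mem_range_transpose (x : Matrix (Fin n ⊕ Fin n) (Fin m) ℂ)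
    {a : Fin m → ℂ} (ha : a ∈ LinearMap.range xᵀ.mulVecLin) : ∃ u, (xᵀ * symJ n) *ᵥ u = a := by
  obtain ⟨y, rfl⟩ := ha
  exact ⟨(symJ n)⁻¹ *ᵥ y, by
    rw [mulVec_mulVec, Matrix.mul_assoc, mul_nonsing_inv _ (isUnit_det_symJ n), Matrix.mul_one,
      mulVecLin_apply]⟩

lemma gram_rank_add_smul_vecMulVec (x : Matrix (Fin n ⊕ Fin n) (Fin m) ℂ)
    {u : Fin n ⊕ Fin n → ℂ} {φ : Fin m → ℂ}
    (ha : (xᵀ * symJ n) *ᵥ u ∉ LinearMap.range (xᵀ * symJ n * x).mulVecLin)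
    (hφ : φ ∉ LinearMap.range (xᵀ * symJ n * x).mulVecLin ⊔
      Submodule.span ℂ {(xᵀ * symJ n) *ᵥ u}) {t : ℂ} (ht : t ≠ 0) :
    ((x + t • vecMulVec u φ)ᵀ * symJ n * (x + t • vecMulVec u φ)).rank =
      (xᵀ * symJ n * x).rank + 2 := by
  rw [← smul_vecMulVec, gram_add_vecMulVec, mulVec_smul]
  refine rank_add_vecMulVec_sub_vecMulVec _ (transpose_gram x) ?_ ?_
  · rwa [Submodule.smul_mem_iff _ ht]
  · rwa [Submodule.span_singleton_smul_eq ht.isUnit]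

lemma exists_mem_notMem_of_finrank_lt {K V : Type*} [Field K] [AddCommGroup V] [Module K V]
    [FiniteDimensional K V] {p q : Submodule K V}
    (h : Module.finrank K p < Module.finrank K q) : ∃ v ∈ q, v ∉ p := by
  by_contra! hc
  exact absurd (Submodule.finrank_mono (fun v hv => hc v hv : q ≤ p)) (not_le.mpr h)

/-- The form rank can be raised by two at constant rank. -/
lemma rankStratum_subset_closure_form {r s : ℕ} (h : s + 2 ≤ r) :
    rankStratum n m r s ⊆ closure (rankStratum n m r (s + 2)) := by
  rintro x ⟨hr, hs⟩
  have hR : Module.finrank ℂ (LinearMap.range xᵀ.mulVecLin) = r := by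
    rw [← hr, ← rank_transpose x]; rfl
  have hC : Module.finrank ℂ (LinearMap.range (xᵀ * symJ n * x).mulVecLin) = s := hs
  obtain ⟨a, haR, haC⟩ := exists_mem_notMem_of_finrank_lt
    (p := LinearMap.range (xᵀ * symJ n * x).mulVecLin) (q := LinearMap.range xᵀ.mulVecLin)
    (by omega)
  obtain ⟨φ, hφR, hφC⟩ := exists_mem_notMem_of_finrank_lt
    (p := LinearMap.range (xᵀ * symJ n * x).mulVecLin ⊔ Submodule.span ℂ {a})
    (q := LinearMap.range xᵀ.mulVecLin)
    (by rw [Submodule.finrank_sup_span_singleton haC]; omega)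
  obtain ⟨u, rfl⟩ := exists_mulVec_eq_of_mem_range_transpose x haR
  obtain ⟨y, rfl⟩ := hφR
  refine mem_closure_of_eventually_add_smul (y := vecMulVec u (xᵀ.mulVecLin y)) ?_
  have hdet : ∀ᶠ t : ℂ in nhds 0, (1 + t • vecMulVec u y).det ≠ 0 := by
    have hc : Continuous fun t : ℂ => (1 + t • vecMulVec u y).det := by fun_prop
    exact hc.continuousAt.eventually_ne (by simp)
  filter_upwards [hdet.filter_mono nhdsWithin_le_nhds, self_mem_nhdsWithin] with t htd ht
  refine ⟨?_, by rw [gram_rank_add_smul_vecMulVec x haC hφC ht, hs]⟩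
  have hfac : x + t • vecMulVec u (xᵀ.mulVecLin y) = (1 + t • vecMulVec u y) * x := by
    rw [Matrix.add_mul, Matrix.one_mul, Matrix.smul_mul, vecMulVec_mul, mulVecLin_apply,
      mulVec_transpose]
  rw [hfac, rank_mul_eq_right_of_isUnit_det _ _ htd.isUnit, hr]

lemma exists_notMem_range_transpose (x : Matrix (Fin n ⊕ Fin n) (Fin m) ℂ) (h : x.rank < m) :
    ∃ φ, φ ∉ LinearMap.range xᵀ.mulVecLin := by
  obtain ⟨φ, -, hφ⟩ := exists_mem_notMem_of_finrank_lt
    (p := LinearMap.range xᵀ.mulVecLin) (q := ⊤)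
    (by rw [finrank_top, Module.finrank_fin_fun]; exact (rank_transpose x).trans_lt h)
  exact ⟨φ, hφ⟩

lemma rank_add_smul_vecMulVec (x : Matrix (Fin n ⊕ Fin n) (Fin m) ℂ)
    {u : Fin n ⊕ Fin n → ℂ} {φ : Fin m → ℂ} (hu : u ∉ LinearMap.range x.mulVecLin)
    (hφ : φ ∉ LinearMap.range xᵀ.mulVecLin) {t : ℂ} (ht : t ≠ 0) :
    (x + t • vecMulVec u φ).rank = x.rank + 1 := by
  rw [← smul_vecMulVec]
  exact rank_add_vecMulVec x (by rwa [Submodule.smul_mem_iff _ ht]) hφ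

/-- When the form is degenerate, the rank can be raised by one and the form rank by two. -/
lemma rankStratum_subset_closure_rank_form {r s : ℕ} (hsr : s < r) (hrm : r < m) :
    rankStratum n m r s ⊆ closure (rankStratum n m (r + 1) (s + 2)) := by
  rintro x ⟨hr, hs⟩
  have hR : Module.finrank ℂ (LinearMap.range xᵀ.mulVecLin) = r := by
    rw [← hr, ← rank_transpose x]; rfl
  have hC : Module.finrank ℂ (LinearMap.range (xᵀ * symJ n * x).mulVecLin) = s := hs
  obtain ⟨a, haR, haC⟩ := exists_mem_notMem_of_finrank_lt
    (p := LinearMap.range (xᵀ * symJ n * x).mulVecLin) (q := LinearMap.range xᵀ.mulVecLin)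
    (by omega)
  obtain ⟨φ, hφ⟩ := exists_notMem_range_transpose x (hr ▸ hrm)
  obtain ⟨u, rfl⟩ := exists_mulVec_eq_of_mem_range_transpose x haR
  have hφC : φ ∉ LinearMap.range (xᵀ * symJ n * x).mulVecLin ⊔
      Submodule.span ℂ {(xᵀ * symJ n) *ᵥ u} := fun h =>
    hφ (sup_le (range_gram_le x) ((Submodule.span_singleton_le_iff_mem _ _).mpr haR) h)
  have hu : u ∉ LinearMap.range x.mulVecLin := by
    rintro ⟨w, rfl⟩
    exact haC ⟨w, by rw [mulVecLin_apply, mulVecLin_apply, mulVec_mulVec]⟩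
  refine mem_closure_of_eventually_add_smul (y := vecMulVec u φ) ?_
  filter_upwards [self_mem_nhdsWithin] with t ht
  exact ⟨by rw [rank_add_smul_vecMulVec x hu hφ ht, hr],
    by rw [gram_rank_add_smul_vecMulVec x haC hφC ht, hs]⟩

/-- The orthogonal complement of the column space is not contained in the column space unless
the column space is coisotropic. -/
lemma exists_orthogonal_notMem_range (x : Matrix (Fin n ⊕ Fin n) (Fin m) ℂ)
    (h : 2 * x.rank < 2 * n + (xᵀ * symJ n * x).rank) :
    ∃ u, (xᵀ * symJ n) *ᵥ u = 0 ∧ u ∉ LinearMap.range x.mulVecLin := by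
  by_contra! hc
  have hle : LinearMap.ker (xᵀ * symJ n).mulVecLin ≤ LinearMap.range x.mulVecLin :=
    fun u hu => hc u hu
  have h₁ := (xᵀ * symJ n).mulVecLin.finrank_range_add_finrank_ker
  have h₂ := ((xᵀ * symJ n).mulVecLin.domRestrict
    (LinearMap.range x.mulVecLin)).finrank_range_add_finrank_ker
  have h₃ : LinearMap.range ((xᵀ * symJ n).mulVecLin.domRestrict (LinearMap.range x.mulVecLin)) =
      LinearMap.range (xᵀ * symJ n * x).mulVecLin := by
    rw [LinearMap.range_domRestrict, mulVecLin_mul _ x, LinearMap.range_comp]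
  have h₄ : Module.finrank ℂ (LinearMap.ker ((xᵀ * symJ n).mulVecLin.domRestrict
      (LinearMap.range x.mulVecLin))) = Module.finrank ℂ (LinearMap.ker (xᵀ * symJ n).mulVecLin) :=
    (Submodule.comapSubtypeEquivOfLe hle).finrank_eq
  have h₅ : (xᵀ * symJ n).rank = x.rank := by
    rw [rank_mul_eq_left_of_isUnit_det _ _ (isUnit_det_symJ n), rank_transpose]
  rw [h₃, h₄] at h₂
  simp only [← Matrix.rank.eq_1, h₅, Module.finrank_fintype_fun_eq_card, Fintype.card_sum,
    Fintype.card_fin] at h₁ h₂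
  omega

/-- The rank can be raised by one at constant form rank. -/
lemma rankStratum_subset_closure_rank {r s : ℕ} (hrm : r < m) (h : 2 * r < 2 * n + s) :
    rankStratum n m r s ⊆ closure (rankStratum n m (r + 1) s) := by
  rintro x ⟨rfl, rfl⟩
  obtain ⟨φ, hφ⟩ := exists_notMem_range_transpose x hrm
  obtain ⟨u, hu₀, hu⟩ := exists_orthogonal_notMem_range x h
  refine mem_closure_of_eventually_add_smul (y := vecMulVec u φ) ?_
  filter_upwards [self_mem_nhdsWithin] with t ht
  refine ⟨rank_add_smul_vecMulVec x hu hφ ht, ?_⟩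
  rw [← smul_vecMulVec, gram_add_vecMulVec, mulVec_smul, hu₀]
  simp

lemma rankStratum_subset_closure {r' s' : ℕ} (hs' : Even s') (hsr' : s' ≤ r') (hrm' : r' ≤ m)
    (hrn' : 2 * r' ≤ 2 * n + s') {r s : ℕ} (hs : Even s) (hr : r ≤ r') (hss' : s ≤ s') :
    rankStratum n m r s ⊆ closure (rankStratum n m r' s') := by
  induction hd : (r' - r) + (s' - s) using Nat.strong_induction_on generalizing r s with
  | _ d ih =>
  have step : ∀ {r₁ s₁ : ℕ}, rankStratum n m r s ⊆ closure (rankStratum n m r₁ s₁) →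
      Even s₁ → r₁ ≤ r' → s₁ ≤ s' → (r' - r₁) + (s' - s₁) < d →
      rankStratum n m r s ⊆ closure (rankStratum n m r' s') := fun h he h₁ h₂ hlt =>
    h.trans (closure_minimal (ih _ hlt he h₁ h₂ rfl) isClosed_closure)
  have hs₂ : Even (s + 2) := hs.add even_two
  rcases hss'.eq_or_lt with rfl | hlt
  · rcases hr.eq_or_lt with rfl | hlt
    · exact subset_closure
    · exact step (rankStratum_subset_closure_rank (by omega) (by omega)) hs (by omega) le_rfl
        (by omega)
  · have hlt₂ : s + 2 ≤ s' := by
      obtain ⟨k, rfl⟩ := hs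
      obtain ⟨k', rfl⟩ := hs'
      omega
    rcases le_or_gt (s + 2) r with h | h
    · exact step (rankStratum_subset_closure_form h) hs₂ hr hlt₂ (by omega)
    · rcases lt_or_ge s r with h' | h'
      · exact step (rankStratum_subset_closure_rank_form h' (by omega)) hs₂ (by omega) hlt₂
          (by omega)
      · exact step (rankStratum_subset_closure_rank (by omega) (by omega)) hs (by omega) hss'
          (by omega)

lemma rankStratum_nonempty {r s : ℕ} (hs : Even s) (hsr : s ≤ r) (hrm : r ≤ m)
    (hrn : 2 * r ≤ 2 * n + s) : (rankStratum n m r s).Nonempty := by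
  have h₀ : (0 : Matrix (Fin n ⊕ Fin n) (Fin m) ℂ) ∈ rankStratum n m 0 0 := by
    simp [rankStratum]
  exact closure_nonempty_iff.mp
    ⟨0, rankStratum_subset_closure hs hsr hrm hrn Even.zero r.zero_le s.zero_le h₀⟩

lemma closure_rankStratum_subset (r s : ℕ) :
    closure (rankStratum n m r s) ⊆ {x | x.rank ≤ r ∧ (xᵀ * symJ n * x).rank ≤ s} := by
  refine closure_minimal (fun x hx => ⟨hx.1.le, hx.2.le⟩) ((isClosed_setOf_rank_le r).inter ?_)
  have hc : Continuous fun x : Matrix (Fin n ⊕ Fin n) (Fin m) ℂ => xᵀ * symJ n * x := by fun_prop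
  exact (isClosed_setOf_rank_le s).preimage hc

end Orbits

/-- For the orbits `O_{rs}` of `Sp(2n,ℂ) × GL(m,ℂ)` on `(2n)×m` matrices,
`O_{rs}` is contained in the closure of `O_{r's'}` iff `r ≤ r'` and `s ≤ s'`. -/
theorem orbit_closure_order (n m : ℕ) (hn : 0 < n) (hm : 0 < m)
    (r s r' s' : ℕ)
    (hs : Even s) (hsr : s ≤ r) (hrm : r ≤ m) (hrn : 2 * r - s ≤ 2 * n)
    (hs' : Even s') (hsr' : s' ≤ r') (hrm' : r' ≤ m) (hrn' : 2 * r' - s' ≤ 2 * n) :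
    ({x : Matrix (Fin n ⊕ Fin n) (Fin m) ℂ |
        x.rank = r ∧ (xᵀ * symJ n * x).rank = s} ⊆
      closure {x : Matrix (Fin n ⊕ Fin n) (Fin m) ℂ |
        x.rank = r' ∧ (xᵀ * symJ n * x).rank = s'}) ↔
      (r ≤ r' ∧ s ≤ s') := by
  change rankStratum n m r s ⊆ closure (rankStratum n m r' s') ↔ _
  constructor
  · intro h
    obtain ⟨x, hx⟩ := rankStratum_nonempty (n := n) hs hsr hrm (by omega)
    have hle := closure_rankStratum_subset r' s' (h hx)
    rw [← hx.1, ← hx.2]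
    exact hle
  · rintro ⟨hr, hss'⟩
    exact rankStratum_subset_closure hs' hsr' hrm' (by omega) hs hr hss'
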